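/- Let n ∈ ℕ, n ≥ 1, let U₁, …, Uₙ ⊂ ℝ be open intervals, let a ∈ C^k(U₁ × ⋯ × Uₙ, ℂ), λ ∈ ℂ \ {0}, and x̃, x ∈ U₁ × ⋯ × Uₙ. Then for every N ≤ k with N ≥ 1, the remainder R_N(x, x̃) := a(x) − Σ_{γ multi-index, |γ| < N} (1/γ!) (D^{λ,(γ)}a)(x̃) (e^{λ(x−x̃)} − 1)^γ satisfies |R_N(x, x̃)| ≤ |λ| · [ Σ_{|γ| = N} (N/γ!) sup_{y ∈ Q(x,x̃)} |(D^{λ,(γ)}a)(y)| ] · ε(λ, ‖x − x̃‖_∞)^{N−1} · ‖x − x̃‖_∞, where ε(λ, r) = sup_{−r ≤ z ≤ r} |e^{λz} − 1|. -/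

import Mathlib

open Complex Filter Finset Nat

/-- The one-variable differential operator `D^{λ,(j)}` applied in the `i`-th coordinate
of a function `(Fin n → ℝ) → ℂ`: `D^{λ,(0)} = Id` and
`D^{λ,(j+1)} = ((1/λ)·∂/∂xᵢ − j·Id) ∘ D^{λ,(j)}`. -/
noncomputable def pD {n : ℕ} (lam : ℂ) (i : Fin n) :
    ℕ → ((Fin n → ℝ) → ℂ) → ((Fin n → ℝ) → ℂ)
  | 0, a => a
  | (j + 1), a => fun x =>
      (1 / lam) * deriv (fun t => pD lam i j a (Function.update x i t)) (x i)
        - (j : ℂ) * pD lam i j a x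

/-- The multi-index operator `D^{λ,(γ)} = D_{x₁}^{λ,(γ₁)} ⋯ D_{xₙ}^{λ,(γₙ)}`. -/
noncomputable def expDm {n : ℕ} (lam : ℂ) (γ : Fin n → ℕ)
    (a : (Fin n → ℝ) → ℂ) : (Fin n → ℝ) → ℂ :=
  (List.finRange n).foldr (fun i g => pD lam i (γ i) g) a

/-- The partial derivative in the `i`-th coordinate. -/
noncomputable def coordDeriv {n : ℕ} (i : Fin n) (f : (Fin n → ℝ) → ℂ) : (Fin n → ℝ) → ℂ :=
  fun x => deriv (fun t => f (Function.update x i t)) (x i)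

/-- The first-order operator `(1/λ)·∂/∂xᵢ − c·Id`. -/
noncomputable def coordStep {n : ℕ} (lam : ℂ) (i : Fin n) (c : ℕ) (f : (Fin n → ℝ) → ℂ) :
    (Fin n → ℝ) → ℂ :=
  fun x => (1 / lam) * coordDeriv i f x - (c : ℂ) * f x

theorem pD_succ {n : ℕ} (lam : ℂ) (i : Fin n) (j : ℕ) (f : (Fin n → ℝ) → ℂ) :
    pD lam i (j + 1) f = coordStep lam i j (pD lam i j f) := rfl

section

variable {n : ℕ} {Ω : Set (Fin n → ℝ)}

theorem coordDeriv_eq_fderiv {f : (Fin n → ℝ) → ℂ} {x : Fin n → ℝ} (i : Fin n)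
    (hf : DifferentiableAt ℝ f x) : coordDeriv i f x = fderiv ℝ f x (Pi.single i 1) := by
  have h1 : HasDerivAt (Function.update x i) (Pi.single i (1 : ℝ)) (x i) :=
    hasDerivAt_update x i (x i)
  have h2 : HasFDerivAt f (fderiv ℝ f x) (Function.update x i (x i)) := by
    simpa using hf.hasFDerivAt
  exact (h2.comp_hasDerivAt (x i) h1).deriv

theorem coordDeriv_congr (hΩ : IsOpen Ω) {f g : (Fin n → ℝ) → ℂ} (h : Set.EqOn f g Ω)
    (i : Fin n) : Set.EqOn (coordDeriv i f) (coordDeriv i g) Ω := by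
  intro x hx
  apply Filter.EventuallyEq.deriv_eq
  have hc : Filter.Tendsto (Function.update x i) (nhds (x i)) (nhds x) := by
    have h1 := (hasDerivAt_update x i (x i)).continuousAt.tendsto
    simpa using h1
  filter_upwards [hc (hΩ.mem_nhds hx)] with t ht using h ht

theorem coordStep_congr (hΩ : IsOpen Ω) (lam : ℂ) {f g : (Fin n → ℝ) → ℂ}
    (h : Set.EqOn f g Ω) (i : Fin n) (c : ℕ) :
    Set.EqOn (coordStep lam i c f) (coordStep lam i c g) Ω := by
  intro x hx
  simp only [coordStep, coordDeriv_congr hΩ h i hx, h hx]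

theorem pD_congr (hΩ : IsOpen Ω) (lam : ℂ) {f g : (Fin n → ℝ) → ℂ}
    (h : Set.EqOn f g Ω) (i : Fin n) (m : ℕ) :
    Set.EqOn (pD lam i m f) (pD lam i m g) Ω := by
  induction m with
  | zero => exact h
  | succ m ih => exact coordStep_congr hΩ lam ih i m

theorem differentiableAt_of_contDiffOn (hΩ : IsOpen Ω) {f : (Fin n → ℝ) → ℂ} {s : ℕ}
    (hf : ContDiffOn ℝ (s + 1 : ℕ) f Ω) {x : Fin n → ℝ} (hx : x ∈ Ω) :
    DifferentiableAt ℝ f x :=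
  (hf.contDiffAt (hΩ.mem_nhds hx)).differentiableAt (by simp)

theorem contDiffOn_coordDeriv (hΩ : IsOpen Ω) {f : (Fin n → ℝ) → ℂ} {s : ℕ}
    (hf : ContDiffOn ℝ (s + 1 : ℕ) f Ω) (i : Fin n) :
    ContDiffOn ℝ s (coordDeriv i f) Ω := by
  have h1 : ContDiffOn ℝ s (fderiv ℝ f) Ω := hf.fderiv_of_isOpen hΩ (by norm_cast)
  exact (h1.clm_apply contDiffOn_const).congr fun x hx =>
    coordDeriv_eq_fderiv i (differentiableAt_of_contDiffOn hΩ hf hx)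

theorem contDiffOn_coordStep (hΩ : IsOpen Ω) (lam : ℂ) {f : (Fin n → ℝ) → ℂ} {s : ℕ}
    (hf : ContDiffOn ℝ (s + 1 : ℕ) f Ω) (i : Fin n) (c : ℕ) :
    ContDiffOn ℝ s (coordStep lam i c f) Ω :=
  (contDiffOn_const.mul (contDiffOn_coordDeriv hΩ hf i)).sub
    (contDiffOn_const.mul (hf.of_le (by norm_cast; omega)))

theorem contDiffOn_pD (hΩ : IsOpen Ω) (lam : ℂ) {f : (Fin n → ℝ) → ℂ} (i : Fin n) (m : ℕ) :
    ∀ {s : ℕ}, ContDiffOn ℝ (s + m : ℕ) f Ω → ContDiffOn ℝ s (pD lam i m f) Ω := by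
  induction m with
  | zero => exact fun hf => hf
  | succ m ih =>
    intro s hf
    exact contDiffOn_coordStep hΩ lam (ih (by rwa [add_right_comm])) i m

theorem coordDeriv_coordStep (hΩ : IsOpen Ω) (lam : ℂ) {f : (Fin n → ℝ) → ℂ}
    (hf : ContDiffOn ℝ (2 : ℕ) f Ω) (i j : Fin n) (c : ℕ) {x : Fin n → ℝ} (hx : x ∈ Ω) :
    coordDeriv i (coordStep lam j c f) x
      = (1 / lam) * coordDeriv i (coordDeriv j f) x - c * coordDeriv i f x := by
  have hf1 := differentiableAt_of_contDiffOn (s := 1) hΩ hf hx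
  have hd := differentiableAt_of_contDiffOn (s := 0) hΩ
    (contDiffOn_coordDeriv (s := 1) hΩ hf j) hx
  have hs := ((hd.hasFDerivAt.const_mul (1 / lam)).sub (hf1.hasFDerivAt.const_mul (c : ℂ)))
  have hs' : HasFDerivAt (coordStep lam j c f) _ x := hs
  rw [coordDeriv_eq_fderiv i hs'.differentiableAt, hs'.fderiv, coordDeriv_eq_fderiv i hd,
    coordDeriv_eq_fderiv i hf1]
  simp

theorem coordDeriv_comm (hΩ : IsOpen Ω) {f : (Fin n → ℝ) → ℂ}
    (hf : ContDiffOn ℝ (2 : ℕ) f Ω) (i j : Fin n) {x : Fin n → ℝ} (hx : x ∈ Ω) :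
    coordDeriv i (coordDeriv j f) x = coordDeriv j (coordDeriv i f) x := by
  have hfd : ContDiffOn ℝ (1 : ℕ) (fderiv ℝ f) Ω := hf.fderiv_of_isOpen hΩ (by norm_cast)
  have hfd' : DifferentiableAt ℝ (fderiv ℝ f) x :=
    (hfd.contDiffAt (hΩ.mem_nhds hx)).differentiableAt (by simp)
  have key (p q : Fin n) : coordDeriv p (coordDeriv q f) x
      = fderiv ℝ (fderiv ℝ f) x (Pi.single p 1) (Pi.single q 1) := by
    have hE : Set.EqOn (coordDeriv q f) (fun y => fderiv ℝ f y (Pi.single q 1)) Ω :=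
      fun y hy => coordDeriv_eq_fderiv q (differentiableAt_of_contDiffOn (s := 1) hΩ hf hy)
    have h1 := hfd'.hasFDerivAt.clm_apply (hasFDerivAt_const (Pi.single q (1 : ℝ)) x)
    rw [coordDeriv_congr hΩ hE p hx, coordDeriv_eq_fderiv p h1.differentiableAt, h1.fderiv]
    simp
  have hsymm : IsSymmSndFDerivAt ℝ f x :=
    (hf.contDiffAt (hΩ.mem_nhds hx)).isSymmSndFDerivAt (by simp)
  rw [key, key, hsymm.eq]

theorem coordStep_comm (hΩ : IsOpen Ω) (lam : ℂ) {f : (Fin n → ℝ) → ℂ}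
    (hf : ContDiffOn ℝ (2 : ℕ) f Ω) (i j : Fin n) (c d : ℕ) :
    Set.EqOn (coordStep lam i c (coordStep lam j d f))
      (coordStep lam j d (coordStep lam i c f)) Ω := by
  intro x hx
  have h1 := coordDeriv_coordStep hΩ lam hf i j d hx
  have h2 := coordDeriv_coordStep hΩ lam hf j i c hx
  have h3 := coordDeriv_comm hΩ hf i j hx
  change 1 / lam * coordDeriv i (coordStep lam j d f) x - c * coordStep lam j d f x
    = 1 / lam * coordDeriv j (coordStep lam i c f) x - d * coordStep lam i c f x
  rw [h1, h2, h3, coordStep, coordStep]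
  ring

theorem coordStep_pD_comm (hΩ : IsOpen Ω) (lam : ℂ) {f : (Fin n → ℝ) → ℂ} (i j : Fin n)
    (c m : ℕ) (hf : ContDiffOn ℝ (m + 1 : ℕ) f Ω) :
    Set.EqOn (coordStep lam i c (pD lam j m f)) (pD lam j m (coordStep lam i c f)) Ω := by
  induction m with
  | zero => exact fun _ _ => rfl
  | succ m ih =>
    have h2 : ContDiffOn ℝ (2 : ℕ) (pD lam j m f) Ω :=
      contDiffOn_pD hΩ lam j m (by convert hf using 2; omega)
    refine (coordStep_comm hΩ lam h2 i j c m).trans ?_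
    exact coordStep_congr hΩ lam (ih (hf.of_le (by norm_cast; omega))) j m

theorem contDiffOn_foldr_pD (hΩ : IsOpen Ω) (lam : ℂ) (γ : Fin n → ℕ) {f : (Fin n → ℝ) → ℂ}
    (l : List (Fin n)) : ∀ {s : ℕ}, ContDiffOn ℝ (s + (l.map γ).sum : ℕ) f Ω →
      ContDiffOn ℝ s (l.foldr (fun i g => pD lam i (γ i) g) f) Ω := by
  induction l with
  | nil => exact fun hf => hf
  | cons j l ih =>
    intro s hf
    refine contDiffOn_pD hΩ lam j (γ j) (ih ?_)
    simpa [add_assoc] using hf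

theorem coordStep_foldr_pD (hΩ : IsOpen Ω) (lam : ℂ) (γ : Fin n → ℕ) {f : (Fin n → ℝ) → ℂ}
    (i : Fin n) (l : List (Fin n)) (hl : l.Nodup) (hi : i ∈ l)
    (hf : ContDiffOn ℝ ((l.map γ).sum + 1 : ℕ) f Ω) :
    Set.EqOn (coordStep lam i (γ i) (l.foldr (fun i g => pD lam i (γ i) g) f))
      (l.foldr (fun j g => pD lam j ((γ + Pi.single i 1 : Fin n → ℕ) j) g) f) Ω := by
  induction l with
  | nil => simp at hi
  | cons j l ih =>
    rw [List.nodup_cons] at hl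
    by_cases hij : i = j
    · subst hij
      have hcongr : l.foldr (fun j g => pD lam j ((γ + Pi.single i 1 : Fin n → ℕ) j) g) f
          = l.foldr (fun i g => pD lam i (γ i) g) f := by
        apply List.foldr_ext
        intro b hb g
        have : b ≠ i := fun h => hl.1 (h ▸ hb)
        simp [this]
      intro x _
      rw [List.foldr_cons, List.foldr_cons, hcongr]
      simp [pD_succ]
    · have hil : i ∈ l := by simpa [hij] using hi
      have hf' : ContDiffOn ℝ (γ j + 1 + (l.map γ).sum : ℕ) f Ω := by
        convert hf using 2
        simp only [List.map_cons, List.sum_cons]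
        omega
      have h1 := coordStep_pD_comm hΩ lam i j (γ i) (γ j)
        (contDiffOn_foldr_pD hΩ lam γ l hf')
      have h2 := pD_congr hΩ lam
        (ih hl.2 hil (hf'.of_le (by norm_cast; omega))) j (γ j)
      intro x hx
      have hji : j ≠ i := fun h => hij h.symm
      simpa [hji] using (h1.trans h2) hx

theorem contDiffOn_expDm (hΩ : IsOpen Ω) (lam : ℂ) (γ : Fin n → ℕ) {f : (Fin n → ℝ) → ℂ}
    {s : ℕ} (hf : ContDiffOn ℝ (s + ∑ i, γ i : ℕ) f Ω) :
    ContDiffOn ℝ s (expDm lam γ f) Ω := by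
  refine contDiffOn_foldr_pD hΩ lam γ _ ?_
  rwa [← List.ofFn_eq_map, List.sum_ofFn]

theorem coordDeriv_expDm (hΩ : IsOpen Ω) {lam : ℂ} (hlam : lam ≠ 0) (γ : Fin n → ℕ)
    {f : (Fin n → ℝ) → ℂ} (hf : ContDiffOn ℝ ((∑ i, γ i) + 1 : ℕ) f Ω) (i : Fin n)
    {x : Fin n → ℝ} (hx : x ∈ Ω) :
    coordDeriv i (expDm lam γ f) x
      = lam * (expDm lam (γ + Pi.single i 1) f x + γ i * expDm lam γ f x) := by
  have h := coordStep_foldr_pD hΩ lam γ (f := f) i (List.finRange n) (List.nodup_finRange n)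
    (List.mem_finRange i) (by rwa [← List.ofFn_eq_map, List.sum_ofFn]) hx
  change coordStep lam i (γ i) (expDm lam γ f) x = expDm lam (γ + Pi.single i 1) f x at h
  rw [← h, coordStep]
  field_simp
  ring

theorem expDm_zero (lam : ℂ) (f : (Fin n → ℝ) → ℂ) : expDm lam 0 f = f := by
  unfold expDm
  induction List.finRange n with
  | nil => rfl
  | cons j l ih => simp only [List.foldr_cons, ih]; rfl

theorem hasDerivAt_comp_line {f : (Fin n → ℝ) → ℂ} (p h : Fin n → ℝ) (t : ℝ)
    (hf : DifferentiableAt ℝ f (p + t • h)) :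
    HasDerivAt (fun s : ℝ => f (p + s • h)) (∑ i, (h i : ℂ) * coordDeriv i f (p + t • h)) t := by
  have h1 : HasDerivAt (fun s : ℝ => p + s • h) h t := by
    simpa using ((hasDerivAt_id t).smul_const h).const_add p
  have h2 := hf.hasFDerivAt.comp_hasDerivAt t h1
  refine h2.congr_deriv ?_
  have hsum : h = ∑ i, h i • (Pi.single i 1 : Fin n → ℝ) := by
    simpa [Pi.single_apply] using pi_eq_sum_univ' h
  rw [congrArg (fderiv ℝ f (p + t • h)) hsum, map_sum]
  refine Finset.sum_congr rfl fun i _ => ?_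
  rw [coordDeriv_eq_fderiv i hf, map_smul, Complex.real_smul]

end

/-- The monomial `E^(γ - eᵢ)`. -/
noncomputable def monoDrop {n : ℕ} (E : Fin n → ℂ) (γ : Fin n → ℕ) (i : Fin n) : ℂ :=
  (∏ j ∈ Finset.univ.erase i, E j ^ γ j) * E i ^ (γ i - 1)

theorem monoDrop_add_single {n : ℕ} (E : Fin n → ℂ) (γ : Fin n → ℕ) (i : Fin n) :
    monoDrop E (γ + Pi.single i 1) i = ∏ j, E j ^ γ j := by
  rw [monoDrop, ← Finset.prod_erase_mul _ _ (Finset.mem_univ i)]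
  congr 1
  · refine Finset.prod_congr rfl fun j hj => ?_
    simp [Finset.ne_of_mem_erase hj]
  · simp

theorem natCast_mul_monoDrop_mul {n : ℕ} (E : Fin n → ℂ) (γ : Fin n → ℕ) (i : Fin n) :
    (γ i : ℂ) * (monoDrop E γ i * E i) = γ i * ∏ j, E j ^ γ j := by
  rcases Nat.eq_zero_or_pos (γ i) with h | h
  · simp [h]
  · rw [monoDrop, ← Finset.prod_erase_mul _ _ (Finset.mem_univ i), mul_assoc (∏ j ∈ _, _),
      pow_sub_one_mul h.ne']

theorem norm_monoDrop_le {n : ℕ} {E : Fin n → ℂ} {ε : ℝ} (hE : ∀ i, ‖E i‖ ≤ ε)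
    (γ : Fin n → ℕ) (i : Fin n) (hi : γ i ≠ 0) :
    ‖monoDrop E γ i‖ ≤ ε ^ (∑ j, γ j - 1) := by
  have hs : ∑ j, γ j - 1 = (∑ j ∈ Finset.univ.erase i, γ j) + (γ i - 1) := by
    rw [← Finset.sum_erase_add _ _ (Finset.mem_univ i)]
    omega
  have hε : 0 ≤ ε := (norm_nonneg _).trans (hE i)
  rw [hs, pow_add, ← Finset.prod_pow_eq_pow_sum, monoDrop, norm_mul, norm_prod, norm_pow]
  simp only [norm_pow]
  gcongr
  · exact hE _
  · exact hE i

theorem sum_piAntidiag_succ {n : ℕ} (m : ℕ) (i : Fin n) (f : (Fin n → ℕ) → ℂ)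
    (hf : ∀ γ, γ i = 0 → f γ = 0) :
    ∑ γ ∈ Finset.piAntidiag Finset.univ (m + 1), f γ
      = ∑ γ ∈ Finset.piAntidiag Finset.univ m, f (γ + Pi.single i 1) := by
  rw [← Finset.sum_image (f := f) (g := fun γ : Fin n → ℕ => γ + Pi.single i 1)
    (fun _ _ _ _ h => add_right_cancel h)]
  symm
  apply Finset.sum_subset
  · intro γ hγ
    obtain ⟨δ, hδ, rfl⟩ := Finset.mem_image.1 hγ
    simp only [Finset.mem_piAntidiag, Finset.mem_univ, implies_true, and_true] at hδ ⊢
    simp [Finset.sum_add_distrib, hδ]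
  · intro γ hγ hγ'
    apply hf
    by_contra h0
    apply hγ'
    have hle : Pi.single i 1 ≤ γ := by
      intro j
      by_cases hj : j = i
      · subst hj; simpa using Nat.one_le_iff_ne_zero.2 h0
      · simp [hj]
    refine Finset.mem_image.2 ⟨γ - Pi.single i 1, ?_, tsub_add_cancel_of_le hle⟩
    simp only [Finset.mem_piAntidiag, Finset.mem_univ, implies_true, and_true] at hγ ⊢
    have : ∑ j, (γ - Pi.single i 1 + Pi.single i 1 : Fin n → ℕ) j = m + 1 := by
      rw [tsub_add_cancel_of_le hle, hγ]
    simpa [Finset.sum_add_distrib, -Pi.sub_apply] using this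

theorem prod_factorial_add_single {n : ℕ} (γ : Fin n → ℕ) (i : Fin n) :
    ∏ j, (((γ + Pi.single i 1 : Fin n → ℕ) j)! : ℂ) = (γ i + 1) * ∏ j, ((γ j)! : ℂ) := by
  rw [← Finset.prod_erase_mul _ _ (Finset.mem_univ i),
    ← Finset.prod_erase_mul (a := i) Finset.univ (fun j => ((γ j)! : ℂ)) (Finset.mem_univ i)]
  have : ∏ j ∈ Finset.univ.erase i, (((γ + Pi.single i 1 : Fin n → ℕ) j)! : ℂ)
      = ∏ j ∈ Finset.univ.erase i, ((γ j)! : ℂ) := by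
    refine Finset.prod_congr rfl fun j hj => ?_
    simp [Finset.ne_of_mem_erase hj]
  rw [this]
  simp [Nat.factorial_succ]
  ring

theorem le_biSup_of_bddAbove {α : Type*} {f : α → ℝ} {S : Set α} (hf : ∀ y, 0 ≤ f y)
    (hb : BddAbove (f '' S)) {y : α} (hy : y ∈ S) : f y ≤ ⨆ z ∈ S, f z := by
  obtain ⟨B, hB⟩ := hb
  have hB' : ∀ z ∈ S, f z ≤ B := fun z hz => hB ⟨z, hz, rfl⟩
  have hbdd : BddAbove (Set.range fun z => ⨆ (_ : z ∈ S), f z) := by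
    refine ⟨B, ?_⟩
    rintro _ ⟨z, rfl⟩
    by_cases hz : z ∈ S
    · simpa [hz] using hB' z hz
    · simpa [hz] using (hf y).trans (hB' y hy)
  refine le_ciSup_of_le hbdd y ?_
  rw [ciSup_pos hy]

/-- The increment `e^{λ(xᵢ - yᵢ)} - 1`. -/
noncomputable def expDelta {n : ℕ} (lam : ℂ) (x y : Fin n → ℝ) (i : Fin n) : ℂ :=
  Complex.exp (lam * (x i - y i)) - 1

/-- The Taylor term of multi-index `γ` of `a`, centred at `y` and evaluated at `x`. -/
noncomputable def expTaylorTerm {n : ℕ} (lam : ℂ) (a : (Fin n → ℝ) → ℂ) (x y : Fin n → ℝ)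
    (γ : Fin n → ℕ) : ℂ :=
  (1 / (∏ i, ((γ i)! : ℂ))) * expDm lam γ a y * ∏ i, expDelta lam x y i ^ γ i

/-- The contribution of `γ` to the derivative of the Taylor polynomial when its centre `y` moves
in direction `h`. -/
noncomputable def expTaylorFlux {n : ℕ} (lam : ℂ) (a : (Fin n → ℝ) → ℂ) (x y h : Fin n → ℝ)
    (γ : Fin n → ℕ) : ℂ :=
  ∑ i, (h i : ℂ) * ((1 / (∏ j, ((γ j)! : ℂ))) * γ i * expDm lam γ a y *
    monoDrop (expDelta lam x y) γ i)

theorem hasDerivAt_expDelta_line {n : ℕ} (lam : ℂ) (x p h : Fin n → ℝ) (i : Fin n) (t : ℝ) :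
    HasDerivAt (fun s : ℝ => expDelta lam x (p + s • h) i)
      (-(lam * h i * (expDelta lam x (p + t • h) i + 1))) t := by
  have h1 : HasDerivAt (fun s : ℝ => lam * ((x i : ℂ) - ((p + s • h) i : ℝ))) (-(lam * h i)) t := by
    have h2 : HasDerivAt (fun s : ℝ => (p + s • h) i) (h i) t := by
      simpa using ((hasDerivAt_id t).mul_const (h i)).const_add (p i)
    simpa using (h2.ofReal_comp.const_sub (x i : ℂ)).const_mul lam
  refine (h1.cexp.sub_const 1).congr_deriv ?_
  rw [expDelta]
  ring

theorem hasDerivAt_prod_expDelta_line {n : ℕ} (lam : ℂ) (x p h : Fin n → ℝ) (γ : Fin n → ℕ)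
    (t : ℝ) :
    HasDerivAt (fun s : ℝ => ∏ i, expDelta lam x (p + s • h) i ^ γ i)
      (-(lam * ∑ i, (h i : ℂ) * (γ i * (∏ j, expDelta lam x (p + t • h) j ^ γ j)
        + γ i * monoDrop (expDelta lam x (p + t • h)) γ i))) t := by
  have h1 := HasDerivAt.fun_finsetProd (u := Finset.univ)
    (f := fun i (s : ℝ) => expDelta lam x (p + s • h) i ^ γ i) (x := t)
    fun i _ => (hasDerivAt_expDelta_line lam x p h i t).pow (γ i)
  refine h1.congr_deriv ?_
  symm
  rw [Finset.mul_sum, ← Finset.sum_neg_distrib]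
  refine Finset.sum_congr rfl fun i _ => ?_
  rw [← natCast_mul_monoDrop_mul, monoDrop, smul_eq_mul]
  ring

theorem hasDerivAt_expTaylorTerm_line {n : ℕ} {Ω : Set (Fin n → ℝ)} (hΩ : IsOpen Ω) {lam : ℂ}
    (hlam : lam ≠ 0) {a : (Fin n → ℝ) → ℂ} (γ : Fin n → ℕ)
    (ha : ContDiffOn ℝ ((∑ i, γ i) + 1 : ℕ) a Ω) (x p h : Fin n → ℝ) (t : ℝ)
    (ht : p + t • h ∈ Ω) :
    HasDerivAt (fun s : ℝ => expTaylorTerm lam a x (p + s • h) γ)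
      (lam * (∑ i, (h i : ℂ) * ((1 / (∏ j, ((γ j)! : ℂ))) *
          expDm lam (γ + Pi.single i 1) a (p + t • h) *
          ∏ j, expDelta lam x (p + t • h) j ^ γ j)
        - expTaylorFlux lam a x (p + t • h) h γ)) t := by
  have hd : DifferentiableAt ℝ (expDm lam γ a) (p + t • h) :=
    differentiableAt_of_contDiffOn (s := 0) hΩ
      (contDiffOn_expDm hΩ lam γ (ha.of_le (by norm_cast; omega))) ht
  have h1 := ((hasDerivAt_comp_line p h t hd).const_mul (1 / (∏ i, ((γ i)! : ℂ)))).mul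
    (hasDerivAt_prod_expDelta_line lam x p h γ t)
  refine h1.congr_deriv ?_
  simp only [expTaylorFlux, coordDeriv_expDm hΩ hlam γ ha _ ht]
  rw [← Finset.sum_sub_distrib]
  simp only [Finset.mul_sum, Finset.sum_mul, ← Finset.sum_neg_distrib, ← Finset.sum_add_distrib]
  refine Finset.sum_congr rfl fun i _ => ?_
  ring

theorem sum_piAntidiag_expTaylorFlux_succ {n : ℕ} (lam : ℂ) (a : (Fin n → ℝ) → ℂ)
    (x y h : Fin n → ℝ) (m : ℕ) :
    ∑ γ ∈ Finset.piAntidiag Finset.univ (m + 1), expTaylorFlux lam a x y h γ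
      = ∑ γ ∈ Finset.piAntidiag Finset.univ m, ∑ i, (h i : ℂ) * ((1 / (∏ j, ((γ j)! : ℂ))) *
          expDm lam (γ + Pi.single i 1) a y * ∏ j, expDelta lam x y j ^ γ j) := by
  simp only [expTaylorFlux]
  rw [Finset.sum_comm, Finset.sum_comm (s := Finset.piAntidiag Finset.univ m)]
  refine Finset.sum_congr rfl fun i _ => ?_
  rw [sum_piAntidiag_succ m i _ (fun γ hγ => by simp [hγ])]
  refine Finset.sum_congr rfl fun γ _ => ?_
  rw [monoDrop_add_single, prod_factorial_add_single]
  have h1 : (γ i + 1 : ℂ) ≠ 0 := Nat.cast_add_one_ne_zero _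
  have h2 : ∏ j, ((γ j)! : ℂ) ≠ 0 :=
    Finset.prod_ne_zero_iff.2 fun j _ => Nat.cast_ne_zero.2 (Nat.factorial_ne_zero _)
  simp only [Pi.add_apply, Pi.single_eq_same, Nat.cast_add, Nat.cast_one]
  field_simp

theorem hasDerivAt_expTaylor_line {n : ℕ} {Ω : Set (Fin n → ℝ)} (hΩ : IsOpen Ω) {lam : ℂ}
    (hlam : lam ≠ 0) {a : (Fin n → ℝ) → ℂ} {N : ℕ} (ha : ContDiffOn ℝ N a Ω)
    (x p h : Fin n → ℝ) (t : ℝ) (ht : p + t • h ∈ Ω) :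
    HasDerivAt (fun s : ℝ => ∑ m ∈ Finset.range N, ∑ γ ∈ Finset.piAntidiag Finset.univ m,
        expTaylorTerm lam a x (p + s • h) γ)
      (lam * ∑ γ ∈ Finset.piAntidiag Finset.univ N, expTaylorFlux lam a x (p + t • h) h γ) t := by
  have h1 := HasDerivAt.fun_sum (u := Finset.range N) (x := t)
    (A := fun m (s : ℝ) => ∑ γ ∈ Finset.piAntidiag Finset.univ m,
      expTaylorTerm lam a x (p + s • h) γ)
    fun m hm => HasDerivAt.fun_sum (u := Finset.piAntidiag Finset.univ m) fun γ hγ =>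
      hasDerivAt_expTaylorTerm_line hΩ hlam γ (ha.of_le (by
        have h2 := (Finset.mem_piAntidiag.1 hγ).1
        have h3 := Finset.mem_range.1 hm
        rw [h2]
        exact_mod_cast h3)) x p h t ht
  refine h1.congr_deriv ?_
  simp only [← Finset.mul_sum, Finset.sum_sub_distrib, ← sum_piAntidiag_expTaylorFlux_succ]
  rw [← Finset.sum_sub_distrib, Finset.sum_range_sub (fun m =>
    ∑ γ ∈ Finset.piAntidiag Finset.univ m, expTaylorFlux lam a x (p + t • h) h γ)]
  simp [expTaylorFlux]

theorem sum_expTaylorTerm_self {n : ℕ} (lam : ℂ) (a : (Fin n → ℝ) → ℂ) (x : Fin n → ℝ) {N : ℕ}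
    (hN : 1 ≤ N) :
    ∑ m ∈ Finset.range N, ∑ γ ∈ Finset.piAntidiag Finset.univ m, expTaylorTerm lam a x x γ
      = a x := by
  rw [Finset.sum_eq_single_of_mem 0 (Finset.mem_range.2 hN)]
  · simp [expTaylorTerm, expDm_zero]
  · intro m _ hm
    refine Finset.sum_eq_zero fun γ hγ => ?_
    have hs := (Finset.mem_piAntidiag.1 hγ).1
    obtain ⟨i, -, hi⟩ := Finset.exists_ne_zero_of_sum_ne_zero (hs.trans_ne hm)
    have : ∏ i, expDelta lam x x i ^ γ i = 0 :=
      Finset.prod_eq_zero (Finset.mem_univ i) (by simp [expDelta, hi])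
    rw [expTaylorTerm, this, mul_zero]

theorem filter_piFinset_range_eq_piAntidiag {n N : ℕ} {m : ℕ} (hm : m < N) :
    (Fintype.piFinset fun _ : Fin n => Finset.range N).filter (fun γ => ∑ i, γ i = m)
      = Finset.piAntidiag Finset.univ m := by
  ext γ
  simp only [Finset.mem_filter, Fintype.mem_piFinset, Finset.mem_range, Finset.mem_piAntidiag,
    Finset.mem_univ, implies_true, and_true, and_iff_right_iff_imp]
  intro h i
  have := Finset.single_le_sum (f := γ) (fun j _ => Nat.zero_le _) (Finset.mem_univ i)
  omega

theorem sum_filter_lt_eq_sum_range {n N : ℕ} (f : (Fin n → ℕ) → ℂ) :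
    ∑ γ ∈ (Fintype.piFinset fun _ : Fin n => Finset.range N).filter (fun γ => ∑ i, γ i < N), f γ
      = ∑ m ∈ Finset.range N, ∑ γ ∈ Finset.piAntidiag Finset.univ m, f γ := by
  rw [← Finset.sum_fiberwise_of_maps_to (t := Finset.range N) (g := fun γ : Fin n → ℕ => ∑ i, γ i)
    (fun γ hγ => Finset.mem_range.2 (Finset.mem_filter.1 hγ).2)]
  refine Finset.sum_congr rfl fun m hm => ?_
  rw [← filter_piFinset_range_eq_piAntidiag (Finset.mem_range.1 hm), Finset.filter_filter]
  congr 1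
  refine Finset.filter_congr fun γ _ => ?_
  have := Finset.mem_range.1 hm
  constructor
  · exact fun h => h.2
  · exact fun h => ⟨h ▸ this, h⟩

theorem norm_expTaylorFlux_le {n : ℕ} {lam : ℂ} {a : (Fin n → ℝ) → ℂ} {x y h : Fin n → ℝ}
    {γ : Fin n → ℕ} {N : ℕ} (hγ : ∑ i, γ i = N) {ε M : ℝ} (hE : ∀ i, ‖expDelta lam x y i‖ ≤ ε)
    (hM : ‖expDm lam γ a y‖ ≤ M) :
    ‖expTaylorFlux lam a x y h γ‖
      ≤ ((N : ℝ) / ∏ i, ((γ i)! : ℝ)) * M * ε ^ (N - 1) * ‖h‖ := by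
  have hM0 : 0 ≤ M := (norm_nonneg _).trans hM
  have hfact : ‖(1 : ℂ) / ∏ j, ((γ j)! : ℂ)‖ = 1 / ∏ j, ((γ j)! : ℝ) := by
    simp [norm_prod]
  calc ‖expTaylorFlux lam a x y h γ‖
      ≤ ∑ i, ‖h‖ * ((1 / ∏ j, ((γ j)! : ℝ)) * γ i * M * ε ^ (N - 1)) := by
        refine norm_sum_le_of_le _ fun i _ => ?_
        have hprod : (0 : ℝ) ≤ 1 / ∏ j, ((γ j)! : ℝ) := by positivity
        rcases eq_or_ne (γ i) 0 with h0 | h0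
        · simp [h0]
        · rw [norm_mul, norm_mul, norm_mul, norm_mul, hfact, Complex.norm_natCast,
            Complex.norm_real]
          have hmono := norm_monoDrop_le hE γ i h0
          rw [hγ] at hmono
          gcongr
          exact norm_le_pi_norm h i
    _ = ((N : ℝ) / ∏ i, ((γ i)! : ℝ)) * M * ε ^ (N - 1) * ‖h‖ := by
        rw [← Finset.mul_sum, ← Finset.sum_mul, ← Finset.sum_mul, ← Finset.mul_sum, ← hγ]
        push_cast
        ring

theorem multivariable_exp_taylor_remainder_bound
    (n : ℕ) (hn : 1 ≤ n) (U : Fin n → Set ℝ)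
    (hU : ∀ i, IsOpen (U i)) (hU' : ∀ i, (U i).OrdConnected)
    (k : ℕ) (a : (Fin n → ℝ) → ℂ) (ha : ContDiffOn ℝ k a (Set.univ.pi U))
    (lam : ℂ) (hlam : lam ≠ 0)
    (xt x : Fin n → ℝ) (hxt : xt ∈ Set.univ.pi U) (hx : x ∈ Set.univ.pi U)
    (N : ℕ) (hN : N ≤ k) (hN1 : 1 ≤ N)
    (R : ℂ)
    (hR : R = a x - ∑ γ ∈ (Fintype.piFinset fun _ : Fin n => Finset.range N).filter
        (fun γ => ∑ i, γ i < N),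
      (1 / (∏ i, ((γ i)! : ℂ))) * expDm lam γ a xt
        * ∏ i, (Complex.exp (lam * (x i - xt i)) - 1) ^ γ i) :
    ‖R‖ ≤ ‖lam‖ *
      (∑ γ ∈ (Fintype.piFinset fun _ : Fin n => Finset.range (N + 1)).filter
          (fun γ => ∑ i, γ i = N),
        ((N : ℝ) / ∏ i, ((γ i)! : ℝ)) *
          ⨆ y ∈ Set.univ.pi (fun i => Set.uIcc (x i) (xt i)), ‖expDm lam γ a y‖)
      * (⨆ z ∈ Set.Icc (-‖x - xt‖) ‖x - xt‖, ‖Complex.exp (lam * z) - 1‖) ^ (N - 1)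
      * ‖x - xt‖ := by

  set Ω : Set (Fin n → ℝ) := Set.univ.pi U
  have hΩ : IsOpen Ω := isOpen_set_pi Set.finite_univ fun i _ => hU i
  have haN : ContDiffOn ℝ N a Ω := ha.of_le (by exact_mod_cast hN)
  set h : Fin n → ℝ := x - xt with hh
  set K : Set (Fin n → ℝ) := Set.univ.pi (fun i => Set.uIcc (x i) (xt i))
  have hKΩ : K ⊆ Ω := Set.pi_mono fun i _ =>
    (hU' i).uIcc_subset (hx i (Set.mem_univ i)) (hxt i (Set.mem_univ i))
  have hKc : IsCompact K := isCompact_univ_pi fun i => isCompact_uIcc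
  have hline : ∀ t ∈ Set.Icc (0 : ℝ) 1, xt + t • h ∈ K := by
    intro t ht i _
    change (xt + t • h) i ∈ Set.uIcc (x i) (xt i)
    rw [Set.uIcc_comm, ← segment_eq_uIcc, segment_eq_image']
    exact ⟨t, ht, rfl⟩
  set ε : ℝ := ⨆ z ∈ Set.Icc (-‖h‖) ‖h‖, ‖Complex.exp (lam * z) - 1‖
  have hεle : ∀ t ∈ Set.Icc (0 : ℝ) 1, ∀ i, ‖expDelta lam x (xt + t • h) i‖ ≤ ε := by
    intro t ht i
    have hz : (x i - (xt + t • h) i) ∈ Set.Icc (-‖h‖) ‖h‖ := by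
      have he : x i - (xt + t • h) i = (1 - t) * h i := by
        simp [hh]
        ring
      rw [Set.mem_Icc, ← abs_le, he, abs_mul, abs_of_nonneg (by linarith [ht.2])]
      have h1 : |h i| ≤ ‖h‖ := norm_le_pi_norm h i
      nlinarith [abs_nonneg (h i), ht.1, ht.2]
    have hb : BddAbove ((fun z : ℝ => ‖Complex.exp (lam * z) - 1‖) '' Set.Icc (-‖h‖) ‖h‖) :=
      isCompact_Icc.bddAbove_image (by fun_prop)
    have := le_biSup_of_bddAbove (fun z : ℝ => norm_nonneg (Complex.exp (lam * z) - 1)) hb hz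
    rwa [Complex.ofReal_sub] at this
  set M : (Fin n → ℕ) → ℝ := fun γ => ⨆ y ∈ K, ‖expDm lam γ a y‖
  have hMle : ∀ γ ∈ Finset.piAntidiag Finset.univ N, ∀ y ∈ K, ‖expDm lam γ a y‖ ≤ M γ := by
    intro γ hγ y hy
    have hc : ContDiffOn ℝ (0 : ℕ) (expDm lam γ a) Ω :=
      contDiffOn_expDm hΩ lam γ (by rwa [(Finset.mem_piAntidiag.1 hγ).1, Nat.zero_add])
    exact le_biSup_of_bddAbove (f := fun y => ‖expDm lam γ a y‖) (fun _ => norm_nonneg _)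
      (hKc.bddAbove_image (hc.continuousOn.mono hKΩ).norm) hy
  set F : ℝ → ℂ := fun s => ∑ m ∈ Finset.range N, ∑ γ ∈ Finset.piAntidiag Finset.univ m,
    expTaylorTerm lam a x (xt + s • h) γ with hF
  have hF1 : F 1 = a x := by
    have : xt + (1 : ℝ) • h = x := by simp [hh]
    simp only [hF, this]
    exact sum_expTaylorTerm_self lam a x hN1
  have hRF : R = F 1 - F 0 := by
    rw [hF1, hR, sum_filter_lt_eq_sum_range]
    simp [hF, expTaylorTerm, expDelta]
  rw [filter_piFinset_range_eq_piAntidiag (Nat.lt_succ_self N), hRF]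
  refine norm_image_sub_le_of_norm_deriv_le_segment_01'
    (fun t ht => (hasDerivAt_expTaylor_line hΩ hlam haN x xt h t
      (hKΩ (hline t ht))).hasDerivWithinAt) fun t ht => ?_
  have ht' := Set.Ico_subset_Icc_self ht
  rw [norm_mul, mul_assoc ‖lam‖, mul_assoc ‖lam‖, Finset.sum_mul, Finset.sum_mul]
  gcongr
  refine norm_sum_le_of_le _ fun γ hγ => ?_
  exact norm_expTaylorFlux_le (Finset.mem_piAntidiag.1 hγ).1 (hεle t ht')
    (hMle γ hγ _ (hline t ht'))
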